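/- Let I, J ⊂ S = K[x_1,…,x_n] be monomial ideals, with G(J) = {u_1,…,u_k} the set of minimal monomial generators of J. Then sdepth_S(I : J) ≥ sdepth_S(I : u_1) + sdepth_S(I : u_2) + … + sdepth_S(I : u_k) − n(k−1) ≥ k·sdepth_S(I) − n(k−1), where (I : J) = { f ∈ S : fJ ⊆ I }. -/

import Mathlib

open MvPolynomial

/-- The `K`-subspace `m·K[Z]` of `S = K[x_0,…,x_{n-1}]`, where `m` is the monomial with
exponent vector `a` and `Z` is a set of variables: the span of all monomials `m·w`
with `w` a monomial in the variables of `Z`. -/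
noncomputable def StanleySpace (K : Type*) [Field K] {n : ℕ} (a : Fin n →₀ ℕ)
    (Z : Finset (Fin n)) : Submodule K (MvPolynomial (Fin n) K) :=
  Submodule.span K
    {p | ∃ c : Fin n →₀ ℕ, c.support ⊆ Z ∧ p = monomial (a + c) (1 : K)}

/-- `I` is a monomial ideal, i.e. an ideal generated by monomials. -/
def IsMonomialIdeal {K : Type*} [Field K] {n : ℕ}
    (I : Ideal (MvPolynomial (Fin n) K)) : Prop :=
  ∃ G : Set (Fin n →₀ ℕ), I = Ideal.span ((fun a => monomial a (1 : K)) '' G)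

/-- The `K`-subspace of `S` spanned by the monomials lying in `I` but not in `J`.
For monomial ideals `J ⊆ I` this is the canonical `K`-vector space representative
of the `ℤⁿ`-graded module `I/J` inside `S`. -/
noncomputable def monomialSpan (K : Type*) [Field K] {n : ℕ}
    (I J : Ideal (MvPolynomial (Fin n) K)) : Submodule K (MvPolynomial (Fin n) K) :=
  Submodule.span K
    {p | ∃ a : Fin n →₀ ℕ, p = monomial a (1 : K) ∧
      monomial a (1 : K) ∈ I ∧ monomial a (1 : K) ∉ J}

/-- The family `(a i, Z i), i = 1,…,r` is a Stanley decomposition of the module `I/J`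
(represented by the span of the monomials of `I \ J`): the Stanley spaces
`(a i)·K[Z i]` are independent and their (direct) sum is all of `I/J`. -/
def IsStanleyDecomp (K : Type*) [Field K] {n r : ℕ}
    (I J : Ideal (MvPolynomial (Fin n) K))
    (a : Fin r → (Fin n →₀ ℕ)) (Z : Fin r → Finset (Fin n)) : Prop :=
  iSupIndep (fun i => StanleySpace K (a i) (Z i)) ∧
    (⨆ i, StanleySpace K (a i) (Z i)) = monomialSpan K I J

/-- The Stanley depth `sdepth_S (I/J)` of the module `I/J`, where `J ⊆ I ⊆ S` are
monomial ideals: the largest `d` such that there is a Stanley decomposition of `I/J`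
all of whose Stanley spaces use at least `d` variables.  (As `ℕ∞`: the Stanley depth
of the zero module, which admits the empty decomposition, is `⊤`.)
`sdepth K I ⊥` is `sdepth_S I` and `sdepth K ⊤ I` is `sdepth_S (S/I)`. -/
noncomputable def sdepth (K : Type*) [Field K] {n : ℕ}
    (I J : Ideal (MvPolynomial (Fin n) K)) : ℕ∞ :=
  sSup {d : ℕ∞ | ∃ (r : ℕ) (a : Fin r → (Fin n →₀ ℕ)) (Z : Fin r → Finset (Fin n)),
    IsStanleyDecomp K I J a Z ∧ ∀ i, d ≤ ((Z i).card : ℕ∞)}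

/-- The depth `depth_S M` of an `S`-module `M` with respect to the maximal graded
ideal `(x_0,…,x_{n-1})`: the supremum of the lengths of `M`-regular sequences
contained in that ideal. -/
noncomputable def gradedDepth (K : Type*) [Field K] (n : ℕ) (M : Type*)
    [AddCommGroup M] [Module (MvPolynomial (Fin n) K) M] : ℕ∞ :=
  sSup {k : ℕ∞ | ∃ rs : List (MvPolynomial (Fin n) K), (rs.length : ℕ∞) = k ∧
    (∀ x ∈ rs, x ∈ Ideal.span (Set.range (X : Fin n → MvPolynomial (Fin n) K))) ∧
    RingTheory.Sequence.IsRegular M rs}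

/-- Extension of an ideal along an inclusion of polynomial rings induced by a map
of variables (`IS`, for `f` injective). -/
noncomputable def extIdeal {K : Type*} [Field K] {m n : ℕ} (f : Fin m → Fin n)
    (I : Ideal (MvPolynomial (Fin m) K)) : Ideal (MvPolynomial (Fin n) K) :=
  Ideal.map (rename f : MvPolynomial (Fin m) K →ₐ[K] MvPolynomial (Fin n) K) I

/-- The inclusion of the variables of `S'' = K[x_{r+1},…,x_n]` into those of
`S = K[x_1,…,x_n]` (variables indexed from `0`). -/
def sndEmbed {n r : ℕ} (h : r ≤ n) : Fin (n - r) → Fin n :=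
  fun i => ⟨r + i.1, by have := i.2; omega⟩

/-- The inclusion of the variables of `S'' = K[x_s,…,x_n]` into those of
`S = K[x_1,…,x_n]` (variables indexed from `0`). -/
def midEmbed {n s : ℕ} (hs : 1 ≤ s) (hsn : s ≤ n) : Fin (n + 1 - s) → Fin n :=
  fun i => ⟨s - 1 + i.1, by have := i.2; omega⟩

/-- The exponent vectors of the monomials in the Stanley space `x^a K[Z]`. -/
def stanleyBox {n : ℕ} (a : Fin n →₀ ℕ) (Z : Finset (Fin n)) : Set (Fin n →₀ ℕ) :=
  {b | a ≤ b ∧ ∀ j ∉ Z, b j = a j}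

lemma self_mem_stanleyBox {n : ℕ} (a : Fin n →₀ ℕ) (Z : Finset (Fin n)) :
    a ∈ stanleyBox a Z :=
  ⟨le_rfl, fun _ _ => rfl⟩

lemma stanleySpace_eq_span_image (K : Type*) [Field K] {n : ℕ} (a : Fin n →₀ ℕ)
    (Z : Finset (Fin n)) :
    StanleySpace K a Z =
      Submodule.span K ((fun b => monomial b (1 : K)) '' stanleyBox a Z) := by
  unfold StanleySpace
  congr 1
  ext p
  constructor
  · rintro ⟨c, hc, rfl⟩
    refine ⟨a + c, ⟨le_self_add, fun j hj => ?_⟩, rfl⟩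
    have : c j = 0 := Finsupp.notMem_support_iff.1 fun h => hj (hc h)
    simp [this]
  · rintro ⟨b, ⟨hab, hb⟩, rfl⟩
    refine ⟨b - a, fun j hj => ?_, by simp [add_tsub_cancel_of_le hab]⟩
    by_contra hjZ
    simp [hb j hjZ] at hj

lemma monomialSpan_bot_eq_span_image (K : Type*) [Field K] {n : ℕ}
    (I : Ideal (MvPolynomial (Fin n) K)) :
    monomialSpan K I ⊥ = Submodule.span K
      ((fun b => monomial b (1 : K)) '' {b | monomial b (1 : K) ∈ I}) := by
  unfold monomialSpan
  congr 1
  ext p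
  constructor
  · rintro ⟨a, rfl, ha, -⟩
    exact ⟨a, ha, rfl⟩
  · rintro ⟨a, ha, rfl⟩
    exact ⟨a, rfl, ha, by simp⟩

lemma linearIndependent_monomial (K : Type*) [Field K] (σ : Type*) :
    LinearIndependent K (fun b : σ →₀ ℕ => monomial b (1 : K)) := by
  simpa using (basisMonomials σ K).linearIndependent

lemma monomial_mem_span_image_iff (K : Type*) [Field K] {σ : Type*} (b : σ →₀ ℕ)
    (B : Set (σ →₀ ℕ)) :
    monomial b (1 : K) ∈ Submodule.span K ((fun b => monomial b (1 : K)) '' B) ↔ b ∈ B :=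
  ⟨fun h => by
    by_contra hb
    exact (linearIndependent_monomial K σ).notMem_span_image hb h,
   fun h => Submodule.subset_span ⟨b, h, rfl⟩⟩

/-- A Stanley decomposition of a monomial ideal is a partition of its exponents into boxes. -/
lemma isStanleyDecomp_bot_iff (K : Type*) [Field K] {n r : ℕ}
    (I : Ideal (MvPolynomial (Fin n) K))
    (a : Fin r → (Fin n →₀ ℕ)) (Z : Fin r → Finset (Fin n)) :
    IsStanleyDecomp K I ⊥ a Z ↔
      Pairwise (Function.onFun Disjoint fun i => stanleyBox (a i) (Z i)) ∧
        ∀ b, monomial b (1 : K) ∈ I ↔ ∃ i, b ∈ stanleyBox (a i) (Z i) := by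
  unfold IsStanleyDecomp
  simp only [stanleySpace_eq_span_image, monomialSpan_bot_eq_span_image]
  rw [← Submodule.span_iUnion, ← Set.image_iUnion]
  refine and_congr ⟨fun h i j hij => ?_, fun h i => ?_⟩ ⟨fun h b => ?_, fun h => ?_⟩
  · refine Set.disjoint_left.2 fun b hi hj => ?_
    have := Submodule.disjoint_def.1 (h.pairwiseDisjoint hij) (monomial b 1)
      ((monomial_mem_span_image_iff K b _).2 hi) ((monomial_mem_span_image_iff K b _).2 hj)
    simp at this
  · simp only [← Submodule.span_iUnion, ← Set.image_iUnion]
    refine (linearIndependent_monomial K _).disjoint_span_image ?_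
    simp only [Set.disjoint_iUnion_right]
    exact fun j hj => h hj.symm
  · rw [← Set.mem_iUnion, ← monomial_mem_span_image_iff K b (⋃ i, _), h,
      monomial_mem_span_image_iff, Set.mem_ofPred_eq]
  · congr 2
    ext b
    rw [Set.mem_iUnion, Set.mem_ofPred_eq, h]

/-- `I` has a Stanley decomposition all of whose spaces have dimension at least `d`. -/
def HasStanleyDecomp (K : Type*) [Field K] {n : ℕ} (I : Ideal (MvPolynomial (Fin n) K))
    (d : ℕ∞) : Prop :=
  ∃ (r : ℕ) (a : Fin r → (Fin n →₀ ℕ)) (Z : Fin r → Finset (Fin n)),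
    IsStanleyDecomp K I ⊥ a Z ∧ ∀ i, d ≤ ((Z i).card : ℕ∞)

lemma hasStanleyDecomp_of_partition (K : Type*) [Field K] {n : ℕ} {ι : Type*} [Finite ι]
    {I : Ideal (MvPolynomial (Fin n) K)} {d : ℕ∞} (B : ι → Set (Fin n →₀ ℕ))
    (hB : ∀ i, (B i).Nonempty → ∃ a Z, B i = stanleyBox a Z ∧ d ≤ (Z.card : ℕ∞))
    (hdisj : Pairwise (Function.onFun Disjoint B))
    (hcov : ∀ b, monomial b (1 : K) ∈ I ↔ ∃ i, b ∈ B i) : HasStanleyDecomp K I d := by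
  obtain ⟨r, ⟨e⟩⟩ := Finite.exists_equiv_fin {i // (B i).Nonempty}
  choose a Z haZ hd using fun i : {i // (B i).Nonempty} => hB i i.2
  refine ⟨r, fun i => a (e.symm i), fun i => Z (e.symm i),
    (isStanleyDecomp_bot_iff K I _ _).2 ⟨fun i j hij => ?_, fun b => ?_⟩, fun i => hd _⟩
  · simp only [Function.onFun, ← haZ]
    exact hdisj fun h => hij (e.symm.injective (Subtype.ext h))
  · simp only [← haZ, hcov]
    constructor
    · rintro ⟨i, hi⟩
      exact ⟨e ⟨i, ⟨b, hi⟩⟩, by simpa using hi⟩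
    · rintro ⟨i, hi⟩
      exact ⟨_, hi⟩

lemma monomial_mem_colon_span_range_iff {K : Type*} [Field K] {n : ℕ} {ι : Type*}
    (I : Ideal (MvPolynomial (Fin n) K)) (u : ι → (Fin n →₀ ℕ)) (b : Fin n →₀ ℕ) :
    monomial b (1 : K) ∈ I.colon (Ideal.span (Set.range fun i => monomial (u i) (1 : K))) ↔
      ∀ i, monomial (b + u i) (1 : K) ∈ I := by
  rw [Submodule.mem_colon]
  constructor
  · intro h i
    simpa [monomial_mul] using h _ (Ideal.subset_span ⟨i, rfl⟩)
  · intro h p hp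
    refine Submodule.span_induction ?_ ?_ ?_ ?_ hp
    · rintro _ ⟨i, rfl⟩
      simpa [monomial_mul] using h i
    · simp
    · intro x y _ _ hx hy
      rw [smul_add]
      exact I.add_mem hx hy
    · intro c x _ hx
      rw [smul_comm]
      exact I.smul_mem c hx

lemma monomial_mem_colon_span_singleton_iff {K : Type*} [Field K] {n : ℕ}
    (I : Ideal (MvPolynomial (Fin n) K)) (u b : Fin n →₀ ℕ) :
    monomial b (1 : K) ∈ I.colon (Ideal.span {monomial u (1 : K)}) ↔
      monomial (b + u) (1 : K) ∈ I := by
  simp [monomial_mul]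

lemma stanleyBox_preimage_add {n : ℕ} {a u : Fin n →₀ ℕ} {Z : Finset (Fin n)}
    (h : {b | b + u ∈ stanleyBox a Z}.Nonempty) :
    {b | b + u ∈ stanleyBox a Z} = stanleyBox (a - u) Z := by
  obtain ⟨c, -, hc⟩ := h
  ext b
  simp only [stanleyBox, Set.mem_ofPred_eq, tsub_le_iff_right]
  refine and_congr_right fun _ => forall₂_congr fun j hj => ?_
  have := hc j hj
  simp only [Finsupp.add_apply, Finsupp.tsub_apply] at this ⊢
  omega

lemma HasStanleyDecomp.colon_monomial {K : Type*} [Field K] {n : ℕ}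
    {I : Ideal (MvPolynomial (Fin n) K)} {d : ℕ∞} (h : HasStanleyDecomp K I d)
    (u : Fin n →₀ ℕ) :
    HasStanleyDecomp K (I.colon (Ideal.span {monomial u (1 : K)})) d := by
  obtain ⟨r, a, Z, hdec, hd⟩ := h
  obtain ⟨hdisj, hcov⟩ := (isStanleyDecomp_bot_iff K I a Z).1 hdec
  refine hasStanleyDecomp_of_partition K (fun i => {b | b + u ∈ stanleyBox (a i) (Z i)})
    (fun i hi => ⟨_, _, stanleyBox_preimage_add hi, hd i⟩)
    (fun i j hij => Disjoint.preimage (· + u) (hdisj hij)) fun b => ?_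
  rw [monomial_mem_colon_span_singleton_iff, hcov]
  rfl

lemma stanleyBox_iInter {n : ℕ} {ι : Type*} [Fintype ι] {a : ι → (Fin n →₀ ℕ)}
    {Z : ι → Finset (Fin n)} (h : (⋂ i, stanleyBox (a i) (Z i)).Nonempty) :
    ⋂ i, stanleyBox (a i) (Z i) =
      stanleyBox (Finset.univ.sup a) {j | ∀ i, j ∈ Z i} := by
  obtain ⟨c, hc⟩ := h
  rw [Set.mem_iInter] at hc
  have hsup : ∀ i, ∀ j ∉ Z i, Finset.univ.sup a j = a i j := fun i j hj =>
    le_antisymm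
      ((Finset.sup_le (fun i _ => (hc i).1) : Finset.univ.sup a ≤ c) j |>.trans_eq
        ((hc i).2 j hj))
      (Finset.le_sup (f := a) (Finset.mem_univ i) j)
  ext b
  simp only [Set.mem_iInter, stanleyBox, Set.mem_ofPred_eq, Finset.mem_filter, Finset.mem_univ,
    true_and, not_forall, Finset.sup_le_iff, true_imp_iff, forall_and, forall_exists_index]
  refine and_congr_right fun _ => ⟨fun h j i hj => ?_, fun h i j hj => ?_⟩
  · rw [h i j hj, hsup i j hj]
  · rw [h j i hj, hsup i j hj]

lemma sum_card_le_card_forall_mem {n : ℕ} {ι : Type*} [Fintype ι] [Nonempty ι]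
    (Z : ι → Finset (Fin n)) :
    ∑ i, (Z i).card ≤
      ({j | ∀ i, j ∈ Z i} : Finset (Fin n)).card + n * (Fintype.card ι - 1) := by
  set W : Finset (Fin n) := {j | ∀ i, j ∈ Z i} with hW
  have hle : Wᶜ.card ≤ ∑ i, ((Z i)ᶜ).card := by
    refine le_trans (Finset.card_le_card fun j hj => ?_)
      (Finset.card_biUnion_le (s := Finset.univ) (t := fun i => (Z i)ᶜ))
    simpa [hW] using hj
  have hadd : ∑ i, (Z i).card + ∑ i, ((Z i)ᶜ).card = Fintype.card ι * n := by
    simp [← Finset.sum_add_distrib, Finset.card_add_card_compl]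
  have hWn : W.card + Wᶜ.card = n := by simp [Finset.card_add_card_compl]
  obtain ⟨m, hm⟩ := Nat.exists_eq_add_of_le' (Fintype.card_pos (α := ι))
  rw [hm] at hadd ⊢
  simp only [Nat.add_sub_cancel]
  nlinarith

lemma HasStanleyDecomp.of_forall_mem_iff {K : Type*} [Field K] {n : ℕ} {ι : Type*} [Fintype ι]
    [Nonempty ι] {I : Ideal (MvPolynomial (Fin n) K)} {L : ι → Ideal (MvPolynomial (Fin n) K)}
    (hL : ∀ b, monomial b (1 : K) ∈ I ↔ ∀ i, monomial b (1 : K) ∈ L i)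
    {d : ι → ℕ∞} (h : ∀ i, HasStanleyDecomp K (L i) (d i)) :
    HasStanleyDecomp K I (∑ i, d i - ((n * (Fintype.card ι - 1) : ℕ) : ℕ∞)) := by
  choose r a Z hdec hd using h
  have hdec' := fun i => (isStanleyDecomp_bot_iff K (L i) (a i) (Z i)).1 (hdec i)
  refine hasStanleyDecomp_of_partition K (ι := ∀ i, Fin (r i))
    (fun f => ⋂ i, stanleyBox (a i (f i)) (Z i (f i)))
    (fun f hf => ⟨_, _, stanleyBox_iInter hf, ?_⟩) (fun f g hfg => ?_) fun b => ?_
  · rw [tsub_le_iff_right]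
    calc ∑ i, d i ≤ ∑ i, ((Z i (f i)).card : ℕ∞) := Finset.sum_le_sum fun i _ => hd i (f i)
      _ ≤ _ := mod_cast sum_card_le_card_forall_mem fun i => Z i (f i)
  · obtain ⟨i, hi⟩ := Function.ne_iff.1 hfg
    exact ((hdec' i).1 hi).mono (Set.iInter_subset _ i) (Set.iInter_subset _ i)
  · simp only [hL, (hdec' _).2, Set.mem_iInter]
    exact Classical.skolem

lemma HasStanleyDecomp.le_of_monomial_mem {K : Type*} [Field K] {n : ℕ}
    {I : Ideal (MvPolynomial (Fin n) K)} {d : ℕ∞} (h : HasStanleyDecomp K I d)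
    {b : Fin n →₀ ℕ} (hb : monomial b (1 : K) ∈ I) : d ≤ n := by
  obtain ⟨r, a, Z, hdec, hd⟩ := h
  obtain ⟨i, -⟩ := (((isStanleyDecomp_bot_iff K I a Z).1 hdec).2 b).1 hb
  exact (hd i).trans (mod_cast (Finset.card_le_univ (Z i)).trans_eq (Fintype.card_fin n))

lemma sdepth_bot_le {K : Type*} [Field K] {n : ℕ} {I : Ideal (MvPolynomial (Fin n) K)}
    {b : Fin n →₀ ℕ} (hb : monomial b (1 : K) ∈ I) : sdepth K I ⊥ ≤ n :=
  sSup_le fun _ hd => HasStanleyDecomp.le_of_monomial_mem hd hb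

lemma HasStanleyDecomp.le_sdepth {K : Type*} [Field K] {n : ℕ}
    {I : Ideal (MvPolynomial (Fin n) K)} {d : ℕ∞} (h : HasStanleyDecomp K I d) :
    d ≤ sdepth K I ⊥ :=
  le_sSup h

lemma hasStanleyDecomp_sdepth_or_eq_zero {K : Type*} [Field K] {n : ℕ}
    (I : Ideal (MvPolynomial (Fin n) K)) {b : Fin n →₀ ℕ} (hb : monomial b (1 : K) ∈ I) :
    HasStanleyDecomp K I (sdepth K I ⊥) ∨ sdepth K I ⊥ = 0 := by
  by_cases hne : ∃ d, HasStanleyDecomp K I d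
  · have : Nonempty {d | HasStanleyDecomp K I d} := nonempty_subtype.2 hne
    exact .inl (ENat.sSup_mem_of_nonempty_of_lt_top (s := {d | HasStanleyDecomp K I d})
      ((sdepth_bot_le hb).trans_lt (ENat.natCast_lt_top n)))
  · refine .inr (le_antisymm (sSup_le fun d hd => (hne ⟨d, hd⟩).elim) zero_le)

lemma sdepth_le_sdepth_colon_monomial {K : Type*} [Field K] {n : ℕ}
    (I : Ideal (MvPolynomial (Fin n) K)) (u : Fin n →₀ ℕ) :
    sdepth K I ⊥ ≤ sdepth K (I.colon (Ideal.span {monomial u (1 : K)})) ⊥ :=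
  sSup_le fun _ hd => (HasStanleyDecomp.colon_monomial hd u).le_sdepth

lemma IsMonomialIdeal.exists_monomial_mem {K : Type*} [Field K] {n : ℕ}
    {I : Ideal (MvPolynomial (Fin n) K)} (hI : IsMonomialIdeal I) (hI0 : I ≠ ⊥) :
    ∃ b, monomial b (1 : K) ∈ I := by
  obtain ⟨G, rfl⟩ := hI
  obtain rfl | ⟨g, hg⟩ := G.eq_empty_or_nonempty
  · simp at hI0
  · exact ⟨g, Ideal.subset_span ⟨g, hg, rfl⟩⟩

/-- Let `I, J ⊂ S = K[x_1,…,x_n]` be monomial ideals, with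
`G(J) = {u_1,…,u_k}` the set of minimal monomial generators of `J`.  Then
`sdepth_S(I : J) ≥ sdepth_S(I : u_1) + ⋯ + sdepth_S(I : u_k) - n(k-1)
≥ k·sdepth_S(I) - n(k-1)`. -/
theorem sdepth_colon_bounds {K : Type*} [Field K] {n k : ℕ} (hk : 1 ≤ k)
    (I J : Ideal (MvPolynomial (Fin n) K))
    (hmI : IsMonomialIdeal I) (hI0 : I ≠ ⊥) (hI1 : I ≠ ⊤) (hJ1 : J ≠ ⊤)
    (u : Fin k → (Fin n →₀ ℕ)) (hu : Function.Injective u)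
    (hG : J = Ideal.span (Set.range fun i => MvPolynomial.monomial (u i) (1 : K)))
    (hmin : ∀ (k' : ℕ) (u' : Fin k' → (Fin n →₀ ℕ)),
      J = Ideal.span (Set.range fun i => MvPolynomial.monomial (u' i) (1 : K)) → k ≤ k') :
    sdepth K (I.colon J) ⊥ ≥
      (∑ i, sdepth K (I.colon (Ideal.span {MvPolynomial.monomial (u i) (1 : K)})) ⊥) -
        ((n * (k - 1) : ℕ) : ℕ∞) ∧
    (∑ i, sdepth K (I.colon (Ideal.span {MvPolynomial.monomial (u i) (1 : K)})) ⊥) -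
        ((n * (k - 1) : ℕ) : ℕ∞) ≥
      (k : ℕ∞) * sdepth K I ⊥ - ((n * (k - 1) : ℕ) : ℕ∞) := by
  have hle : ∀ i, sdepth K I ⊥ ≤ sdepth K (I.colon (Ideal.span {monomial (u i) (1 : K)})) ⊥ :=
    fun i => sdepth_le_sdepth_colon_monomial I (u i)
  refine ⟨?_, tsub_le_tsub_right ?_ _⟩
  · obtain ⟨b, hb⟩ := hmI.exists_monomial_mem hI0
    have hmem : ∀ i, monomial b (1 : K) ∈ I.colon (Ideal.span {monomial (u i) (1 : K)}) := by
      intro i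
      rw [monomial_mem_colon_span_singleton_iff]
      simpa [monomial_mul] using I.mul_mem_right (monomial (u i) (1 : K)) hb
    by_cases h : ∃ i, sdepth K (I.colon (Ideal.span {monomial (u i) (1 : K)})) ⊥ = 0
    · obtain ⟨i, hi⟩ := h
      refine le_of_eq_of_le (tsub_eq_zero_of_le ?_) zero_le
      rw [← Finset.sum_erase Finset.univ
        (f := fun i => sdepth K (I.colon (Ideal.span {monomial (u i) (1 : K)})) ⊥) hi]
      refine (Finset.sum_le_card_nsmul _ _ (n : ℕ∞) fun j _ => sdepth_bot_le (hmem j)).trans ?_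
      simp [Finset.card_erase_of_mem, mul_comm]
    · push Not at h
      have : NeZero k := ⟨by omega⟩
      have hcol : ∀ c, monomial c (1 : K) ∈ I.colon J ↔
          ∀ i, monomial c (1 : K) ∈ I.colon (Ideal.span {monomial (u i) (1 : K)}) := fun c => by
        simp only [hG, monomial_mem_colon_span_range_iff, monomial_mem_colon_span_singleton_iff]
      have key := HasStanleyDecomp.of_forall_mem_iff hcol fun i =>
        (hasStanleyDecomp_sdepth_or_eq_zero _ (hmem i)).resolve_right (h i)
      simpa using key.le_sdepth
  · simpa using Finset.sum_le_sum fun i (_ : i ∈ Finset.univ) => hle i
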